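/- Let (X, d) be a metric space, let α, β, γ, δ, ε, ζ : X×X → ℝ, and let T : X → X be an (α, β, γ, δ, ε, ζ)-weighted generalized pseudocontraction. Suppose there exists λ : X×X → [0,1] such that for all x, y ∈ X: α_λ(x,y) + ζ_λ(x,y) + 2·min{β_λ(x,y), 0} ≥ 0 and δ_λ(x,y) + ε_λ(x,y) + 2·min{β_λ(x,y), 0} > 0. Then for every x ∈ X the sequence (Tⁿx)_{n∈ℕ} is a Cauchy sequence. -/

import Mathlib

open Filter Topology

/-- `T` is an `(α, β, γ, δ, ε, ζ)`-weighted generalized pseudocontraction. -/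
def IsWGPseudocontraction {X : Type*} [MetricSpace X]
    (T : X → X) (α β γ δ ε ζ : X → X → ℝ) : Prop :=
  ∀ x y : X,
    α x y * dist (T x) (T y) ^ 2 + β x y * dist x (T y) ^ 2 +
      γ x y * dist (T x) y ^ 2 + δ x y * dist x y ^ 2 +
      ε x y * dist x (T x) ^ 2 + ζ x y * dist y (T y) ^ 2 ≤ 0

/-- The `l`-weighted combination of two coefficient maps:
`(f, g) ↦ (x, y) ↦ (1 − l(x,y))·f(x,y) + l(x,y)·g(y,x)`.
With it: `α_λ = wComb l α α`, `β_λ = wComb l β γ`, `γ_λ = wComb l γ β`,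
`δ_λ = wComb l δ δ`, `ε_λ = wComb l ε ζ`, `ζ_λ = wComb l ζ ε`. -/
def wComb {X : Type*} (l f g : X → X → ℝ) : X → X → ℝ :=
  fun x y => (1 - l x y) * f x y + l x y * g y x

/-- The weighted combinations of the coefficients of a weighted generalized pseudocontraction
are again admissible coefficients for it. -/
theorem IsWGPseudocontraction.wComb {X : Type*} [MetricSpace X] {T : X → X}
    {α β γ δ ε ζ : X → X → ℝ} (hT : IsWGPseudocontraction T α β γ δ ε ζ) {l : X → X → ℝ}
    (hl : ∀ x y, l x y ∈ Set.Icc (0 : ℝ) 1) :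
    IsWGPseudocontraction T (wComb l α α) (wComb l β γ) (wComb l γ β) (wComb l δ δ)
      (wComb l ε ζ) (wComb l ζ ε) := by
  intro x y
  have hxy := mul_nonpos_of_nonneg_of_nonpos (sub_nonneg.2 (hl x y).2) (hT x y)
  have hyx := mul_nonpos_of_nonneg_of_nonpos (hl x y).1 (hT y x)
  rw [dist_comm (T y) (T x), dist_comm y (T x), dist_comm (T y) x, dist_comm y x] at hyx
  simp only [_root_.wComb]
  linarith

/-- If the coefficients satisfy the two positivity conditions, every point is fixed. -/
theorem IsWGPseudocontraction.isFixedPt {X : Type*} [MetricSpace X] {T : X → X}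
    {α β γ δ ε ζ : X → X → ℝ} (hT : IsWGPseudocontraction T α β γ δ ε ζ) (x : X)
    (h₁ : 0 ≤ α x (T x) + ζ x (T x) + 2 * min (β x (T x)) 0)
    (h₂ : 0 < δ x (T x) + ε x (T x) + 2 * min (β x (T x)) 0) :
    Function.IsFixedPt T x := by
  have key := hT x (T x)
  rw [dist_self] at key
  set m := min (β x (T x)) 0
  set a := dist x (T x)
  set b := dist (T x) (T (T x))
  set c := dist x (T (T x))
  have hc : c ^ 2 ≤ 2 * (a ^ 2 + b ^ 2) :=
    (pow_le_pow_left₀ dist_nonneg (dist_triangle x (T x) (T (T x))) 2).trans add_sq_le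
  have hm : m * (2 * (a ^ 2 + b ^ 2)) ≤ m * c ^ 2 :=
    mul_le_mul_of_nonpos_left hc (min_le_right _ _)
  have hβ : m * c ^ 2 ≤ β x (T x) * c ^ 2 :=
    mul_le_mul_of_nonneg_right (min_le_left _ _) (sq_nonneg c)
  have hb := mul_nonneg h₁ (sq_nonneg b)
  have ha : a ^ 2 ≤ 0 := nonpos_of_mul_nonpos_right (by linarith) h₂
  have ha' : a = 0 := pow_eq_zero_iff two_ne_zero |>.1 (ha.antisymm (sq_nonneg a))
  exact (dist_eq_zero.1 ha').symm

theorem stmt_3 {X : Type*} [MetricSpace X] (α β γ δ ε ζ : X → X → ℝ)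
    (T : X → X) (hT : IsWGPseudocontraction T α β γ δ ε ζ)
    (h : ∃ l : X → X → ℝ, (∀ x y : X, l x y ∈ Set.Icc (0 : ℝ) 1) ∧
      ∀ x y : X,
        0 ≤ wComb l α α x y + wComb l ζ ε x y + 2 * min (wComb l β γ x y) 0 ∧
        0 < wComb l δ δ x y + wComb l ε ζ x y + 2 * min (wComb l β γ x y) 0) :
    ∀ x : X, CauchySeq (fun n : ℕ => T^[n] x) := by
  obtain ⟨l, hl, hpos⟩ := h
  intro x
  have hx : Function.IsFixedPt T x :=
    (hT.wComb hl).isFixedPt x (hpos x (T x)).1 (hpos x (T x)).2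
  have hconst : (fun n : ℕ => T^[n] x) = fun _ => x := funext fun n => hx.iterate n
  rw [hconst]
  exact cauchySeq_const x
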